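/- For all integers n ≥ 1 and m ≥ 2, Σ_{p=0}^{m} (−1)^p (m−p−1) C(n+1, m−p) C(n+p−1, p) = 0, where m−p−1 is taken as an integer (so it equals −1 when p = m). -/

import Mathlib

/-- The coefficient of `X ^ k`, for `k` positive, in `(1 + X) ^ n * (1 + X) ^ (-n) = 1`. -/
theorem sum_neg_one_pow_mul_choose_mul_choose_eq_zero {n k : ℕ} (hn : 1 ≤ n) (hk : 0 < k) :
    ∑ p ∈ Finset.range (k + 1),
      (-1 : ℤ) ^ p * (n.choose (k - p)) * ((n + p - 1).choose p) = 0 := by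
  have h := Ring.add_choose_eq k (Commute.all (-(n : ℤ)) n)
  rw [neg_add_cancel, Ring.choose_zero_pos ℤ hk,
    Finset.Nat.sum_antidiagonal_eq_sum_range_succ_mk] at h
  rw [h]
  refine Finset.sum_congr rfl fun p _ => ?_
  have hcast : (n : ℤ) + p - 1 = ((n + p - 1 : ℕ) : ℤ) := by lia
  rw [Ring.choose_neg, hcast, Ring.choose_natCast, Ring.choose_natCast, Units.smul_def,
    Int.coe_negOnePow_natCast, smul_eq_mul]
  ring

theorem mul_choose_succ_succ_eq_sub (n j : ℕ) :
    (j : ℤ) * ((n + 1).choose (j + 1)) = n * n.choose j - n.choose (j + 1) := by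
  have h₁ : ((n + 1 : ℕ) : ℤ) * n.choose j = (n + 1).choose (j + 1) * (j + 1 : ℕ) := by
    exact_mod_cast Nat.add_one_mul_choose_eq n j
  have h₂ : ((n + 1).choose (j + 1) : ℤ) = n.choose j + n.choose (j + 1) := by
    exact_mod_cast Nat.choose_succ_succ n j
  push_cast at h₁
  linear_combination -h₁ - h₂

/-- For all integers `n ≥ 1` and `m ≥ 2`,
`∑_{p=0}^{m} (−1)^p (m−p−1) C(n+1, m−p) C(n+p−1, p) = 0`,
where `m−p−1` is taken as an integer. -/
theorem stmt_12 (n m : ℕ) (hn : 1 ≤ n) (hm : 2 ≤ m) :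
    ∑ p ∈ Finset.range (m + 1),
      (-1 : ℤ) ^ p * ((m : ℤ) - p - 1) * ((n + 1).choose (m - p)) * ((n + p - 1).choose p)
      = 0 := by
  obtain ⟨k, rfl⟩ : ∃ k, m = k + 1 := ⟨m - 1, by lia⟩
  have h₀ := sum_neg_one_pow_mul_choose_mul_choose_eq_zero hn (k := k) (by lia)
  have h₁ := sum_neg_one_pow_mul_choose_mul_choose_eq_zero hn k.succ_pos
  rw [Nat.succ_eq_add_one, Finset.sum_range_succ] at h₁
  have h : ∀ p ∈ Finset.range (k + 1),
      (-1 : ℤ) ^ p * (((k + 1 : ℕ) : ℤ) - p - 1) * ((n + 1).choose (k + 1 - p)) *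
        ((n + p - 1).choose p) =
      n * ((-1 : ℤ) ^ p * (n.choose (k - p)) * ((n + p - 1).choose p)) -
        (-1 : ℤ) ^ p * (n.choose (k + 1 - p)) * ((n + p - 1).choose p) := by
    intro p hp
    obtain ⟨j, rfl⟩ := Nat.exists_eq_add_of_le (Finset.mem_range_succ_iff.mp hp)
    rw [show p + j + 1 - p = j + 1 by lia, show p + j - p = j by lia]
    push_cast
    linear_combination
      (-1 : ℤ) ^ p * ((n + p - 1).choose p) * mul_choose_succ_succ_eq_sub n j
  rw [Finset.sum_range_succ, Finset.sum_congr rfl h, Finset.sum_sub_distrib, ← Finset.mul_sum, h₀]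
  simp only [Nat.sub_self, Nat.choose_zero_right, Nat.cast_one] at h₁ ⊢
  linear_combination -h₁
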